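/- Let N ≥ 2 and let η_1, …, η_{2N} be elements of an associative unital ℂ-algebra, indexed cyclically mod 2N, satisfying η_j η_{j+1} = −η_{j+1} η_j for all j, η_j η_k = η_k η_j whenever k ≢ j±1 (mod 2N), and η_j² = 1 for all j. For l ≥ 1 define A_l = Σ_{j=1}^{N} η_{2j} η_{2j+1} ⋯ η_{2j+2l−2} (the ordered product of the 2l−1 consecutive operators starting at index 2j), A₀ = Σ_{j=1}^{N} η_{2j−1}, A_{−l} = Σ_{j=1}^{N} η_{2j−2l−1} η_{2j−2l} ⋯ η_{2j−1}, and define G₀ = 0, G_l = (1/2) Σ_{j=1}^{N} (η_{2j} η_{2j+1} ⋯ η_{2j+2l−1} − η_{2j−1} η_{2j} ⋯ η_{2j+2l−2}) for l ≥ 1, and G_{−l} = −G_l. Then these elements satisfy the defining relations of the Onsager algebra: [A_j, A_k] = 4 G_{j−k}, [G_m, A_l] = 2 A_{l+m} − 2 A_{l−m}, and [G_j, G_k] = 0 for all integers j, k, l, m. -/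

import Mathlib

/-- The sign `-1` when `x ≡ y` modulo `M`, and `1` otherwise. -/
def congrSign (M x y : ℤ) : ℤ := if M ∣ x - y then -1 else 1

lemma congrSign_of_dvd {M x y : ℤ} (h : M ∣ x - y) : congrSign M x y = -1 := if_pos h

lemma congrSign_of_not_dvd {M x y : ℤ} (h : ¬ M ∣ x - y) : congrSign M x y = 1 := if_neg h

lemma congrSign_mul_self (M x y : ℤ) : congrSign M x y * congrSign M x y = 1 := by
  unfold congrSign; split_ifs <;> rfl

/-- `E a b` is the ordered product of the involutions `η a, …, η (b - 1)`, extended to all pairs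
of integers by `E b a = (E a b)⁻¹`; consecutive `η`'s anticommute, with indices modulo `M`, and
all others commute. -/
structure IsEtaTransport {A : Type*} [Ring A] (M : ℤ) (η : ℤ → A) (E : ℤ → ℤ → A) : Prop where
  refl : ∀ a, E a a = 1
  trans : ∀ a b c, E a b * E b c = E a c
  step : ∀ a, E a (a + 1) = η a
  step_symm : ∀ a, E (a + 1) a = η a
  periodic : ∀ a, η (a + M) = η a
  swap : ∀ a c, η a * η c = (congrSign M a c * congrSign M a (c + 1) *
    (congrSign M (a + 1) c * congrSign M (a + 1) (c + 1))) • (η c * η a)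

lemma exists_int_partialProd {G : Type*} [Group G] (u : ℤ → G) :
    ∃ g : ℤ → G, ∀ n, g (n + 1) = g n * u n := by
  refine ⟨fun n => Int.rec (fun k => Nat.rec 1 (fun i x => x * u i) k)
    (fun k => Nat.rec (u (-1))⁻¹ (fun i x => x * (u (Int.negSucc (i + 1)))⁻¹) k) n, ?_⟩
  intro n
  rcases n with k | k
  · rfl
  · cases k with
    | zero => exact (inv_mul_cancel (u (-1))).symm
    | succ k =>
      have h : Int.negSucc (k + 1) + 1 = Int.negSucc k := by omega
      rw [h]
      simp

lemma IsEtaTransport.exists_of_sq_eq_one {A : Type*} [Ring A] {M : ℤ} {η : ℤ → A}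
    (hsq : ∀ a, η a * η a = 1) (hper : ∀ a, η (a + M) = η a)
    (hswap : ∀ a c, η a * η c = (congrSign M a c * congrSign M a (c + 1) *
      (congrSign M (a + 1) c * congrSign M (a + 1) (c + 1))) • (η c * η a)) :
    ∃ E, IsEtaTransport M η E := by
  obtain ⟨g, hg⟩ := exists_int_partialProd
    (fun a => (⟨η a, η a, hsq a, hsq a⟩ : Aˣ))
  refine ⟨fun a b => (((g a)⁻¹ * g b : Aˣ) : A), ?_, ?_, ?_, ?_, hper, hswap⟩
  · simp
  · intro a b c
    rw [← Units.val_mul]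
    congr 1
    group
  · intro a
    rw [hg, inv_mul_cancel_left]
  · intro a
    rw [hg, mul_inv_rev, inv_mul_cancel_right]
    rfl

namespace IsEtaTransport

variable {A : Type*} [Ring A] {M : ℤ} {η : ℤ → A} {E : ℤ → ℤ → A}

lemma induction_on_right {P : ℤ → Prop} (a : ℤ) (base : P a)
    (succ : ∀ b, P b → P (b + 1)) (pred : ∀ b, P (b + 1) → P b) (b : ℤ) : P b := by
  induction b using Int.inductionOn' (b := a) with
  | zero => exact base
  | succ k _ ih => exact succ k ih
  | pred k _ ih => exact pred _ (by simpa using ih)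

lemma mul_step (h : IsEtaTransport M η E) (a b : ℤ) : E a b * η b = E a (b + 1) := by
  rw [← h.step, h.trans]

lemma mul_step_symm (h : IsEtaTransport M η E) (a b : ℤ) : E a (b + 1) * η b = E a b := by
  rw [← h.step_symm, h.trans]

lemma mul_eta (h : IsEtaTransport M η E) (a b c : ℤ) :
    E a b * η c = (congrSign M a c * congrSign M a (c + 1) *
      (congrSign M b c * congrSign M b (c + 1))) • (η c * E a b) := by
  have hs := congrSign_mul_self M
  induction b using induction_on_right a with
  | base =>
    rw [h.refl, one_mul, mul_one]
    have : congrSign M a c * congrSign M a (c + 1) * (congrSign M a c * congrSign M a (c + 1))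
      = 1 := by
      linear_combination (congrSign M a (c + 1)) ^ 2 * hs a c + hs a (c + 1)
    rw [this, one_smul]
  | succ b ih =>
    rw [← h.mul_step, mul_assoc, h.swap, mul_smul_comm, ← mul_assoc (E a b), ih, smul_mul_assoc,
      smul_smul, mul_assoc (η c)]
    congr 1
    linear_combination (congrSign M a c * congrSign M a (c + 1) * congrSign M (b + 1) c *
      congrSign M (b + 1) (c + 1)) * ((congrSign M b (c + 1)) ^ 2 * hs b c + hs b (c + 1))
  | pred b ih =>
    rw [← h.mul_step_symm, mul_assoc, h.swap, mul_smul_comm, ← mul_assoc (E a (b + 1)), ih,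
      smul_mul_assoc, smul_smul, mul_assoc (η c)]
    congr 1
    linear_combination (congrSign M a c * congrSign M a (c + 1) * congrSign M b c *
      congrSign M b (c + 1)) * ((congrSign M (b + 1) (c + 1)) ^ 2 * hs (b + 1) c +
        hs (b + 1) (c + 1))

lemma mul_comm_sign (h : IsEtaTransport M η E) (a b c d : ℤ) :
    E a b * E c d = (congrSign M a c * congrSign M b c *
      (congrSign M a d * congrSign M b d)) • (E c d * E a b) := by
  have hs := congrSign_mul_self M
  induction d using induction_on_right c with
  | base =>
    rw [h.refl, one_mul, mul_one]
    have : congrSign M a c * congrSign M b c * (congrSign M a c * congrSign M b c) = 1 := by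
      linear_combination (congrSign M b c) ^ 2 * hs a c + hs b c
    rw [this, one_smul]
  | succ d ih =>
    rw [← h.mul_step c, ← mul_assoc, ih, smul_mul_assoc, mul_assoc (E c d), h.mul_eta,
      mul_smul_comm, smul_smul, mul_assoc (E c d)]
    congr 1
    linear_combination (congrSign M a c * congrSign M b c * congrSign M a (d + 1) *
      congrSign M b (d + 1)) * ((congrSign M b d) ^ 2 * hs a d + hs b d)
  | pred d ih =>
    rw [← h.mul_step_symm c, ← mul_assoc, ih, smul_mul_assoc, mul_assoc (E c (d + 1)), h.mul_eta,
      mul_smul_comm, smul_smul, mul_assoc (E c (d + 1))]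
    congr 1
    linear_combination (congrSign M a c * congrSign M b c * congrSign M a d *
      congrSign M b d) * ((congrSign M b (d + 1)) ^ 2 * hs a (d + 1) + hs b (d + 1))

lemma add_period (h : IsEtaTransport M η E) (a b : ℤ) : E (a + M) (b + M) = E a b := by
  induction b using induction_on_right a with
  | base => rw [h.refl, h.refl]
  | succ b ih => rw [add_right_comm, ← h.mul_step, ih, h.periodic, h.mul_step]
  | pred b ih => rw [← h.mul_step_symm, add_right_comm, ih, h.periodic, h.mul_step_symm]

lemma add_zsmul_period (h : IsEtaTransport M η E) (a b t : ℤ) :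
    E (a + M * t) (b + M * t) = E a b := by
  induction t using induction_on_right 0 with
  | base => simp
  | succ t ih => rw [mul_add, mul_one, ← add_assoc, ← add_assoc, h.add_period, ih]
  | pred t ih => rw [← ih, mul_add, mul_one, ← add_assoc, ← add_assoc, h.add_period]

lemma not_dvd_one_of_two_dvd (hM : (2 : ℤ) ∣ M) : ¬ M ∣ 1 := fun h => by
  have := hM.trans h
  omega

lemma symm_sign (h : IsEtaTransport M η E) (hM : ¬ M ∣ 1) (a b : ℤ) :
    E b a = (-congrSign M a b * (Int.negOnePow (b - a) : ℤ)) • E a b := by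
  have hs := congrSign_mul_self M
  have h0 (b : ℤ) : congrSign M b b = -1 := congrSign_of_dvd (by simp)
  have h1 (b : ℤ) : congrSign M b (b + 1) = 1 := congrSign_of_not_dvd (by simpa using hM)
  have h2 (b : ℤ) : congrSign M (b + 1) b = 1 := congrSign_of_not_dvd (by simpa using hM)
  induction b using induction_on_right a with
  | base => simp [h0]
  | succ b ih =>
    rw [← h.trans _ b, ih, h.step_symm, mul_smul_comm, ← h.mul_step, h.mul_eta, smul_smul, h0, h1,
      show b + 1 - a = (b - a) + 1 by ring, Int.negOnePow_succ]
    congr 1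
    push_cast
    linear_combination (congrSign M a b * ((b - a).negOnePow : ℤ)) * hs a (b + 1)
  | pred b ih =>
    rw [← h.trans _ (b + 1), ih, h.step, mul_smul_comm, ← h.mul_step_symm a b, h.mul_eta,
      smul_smul, h0, h2, show b + 1 - a = (b - a) + 1 by ring, Int.negOnePow_succ]
    congr 1
    push_cast
    linear_combination (-congrSign M a (b + 1) * ((b - a).negOnePow : ℤ)) * hs a b

lemma symm_of_odd (h : IsEtaTransport M η E) (hM : (2 : ℤ) ∣ M) {a b : ℤ} (hab : Odd (b - a)) :
    E b a = E a b := by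
  rw [h.symm_sign (not_dvd_one_of_two_dvd hM), Int.negOnePow_odd _ hab, congrSign_of_not_dvd]
  · simp
  · intro hd
    have := hM.trans hd
    rw [Int.odd_iff] at hab
    omega

lemma symm_of_even (h : IsEtaTransport M η E) (hM : (2 : ℤ) ∣ M) {a b : ℤ} (hab : Even (b - a))
    (hd : ¬ M ∣ a - b) : E b a = -E a b := by
  rw [h.symm_sign (not_dvd_one_of_two_dvd hM), Int.negOnePow_even _ hab, congrSign_of_not_dvd hd]
  simp

lemma symm_of_dvd (h : IsEtaTransport M η E) (hM : (2 : ℤ) ∣ M) {a b : ℤ} (hd : M ∣ a - b) :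
    E b a = E a b := by
  have hab : Even (b - a) := by
    have := hM.trans hd
    rw [Int.even_iff]
    omega
  rw [h.symm_sign (not_dvd_one_of_two_dvd hM), Int.negOnePow_even _ hab, congrSign_of_dvd hd]
  simp

lemma add_of_dvd (h : IsEtaTransport M η E) {r : ℤ} (hr : M ∣ r) (a b : ℤ) :
    E (a + r) (b + r) = E a b := by
  obtain ⟨t, rfl⟩ := hr
  exact h.add_zsmul_period a b t

lemma loop_eq (h : IsEtaTransport M η E) {r : ℤ} (hr : M ∣ r) (a b : ℤ) :
    E a (a + r) = E b (b + r) := by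
  have hs := congrSign_mul_self M
  have e : E a b * E b (b + r) = E b (b + r) * E a b := by
    have e1 (x : ℤ) : congrSign M x (b + r) = congrSign M x b := by
      simp only [congrSign, ← sub_sub, dvd_sub_left hr]
    rw [h.mul_comm_sign, e1, e1]
    have : congrSign M a b * congrSign M b b * (congrSign M a b * congrSign M b b) = 1 := by
      linear_combination (congrSign M b b) ^ 2 * hs a b + hs b b
    rw [this, one_smul]
  rw [← h.trans a b, ← h.trans b (b + r), h.add_of_dvd hr, ← mul_assoc, e, mul_assoc, h.trans,
    h.refl, mul_one]

lemma eq_list_prod (h : IsEtaTransport M η E) {R : Type} [NatCast R] (f : R → A) (a b : ℤ)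
    (n : ℕ) (hb : b = a + n) (hf : ∀ i : ℕ, f i = η (a + i)) :
    E a b = (List.map f (do let i ← List.range n; pure (i : R))).prod := by
  subst hb
  simp only [List.pure_def, List.bind_eq_flatMap, ← List.map_eq_flatMap,
    List.map_map]
  induction n with
  | zero => simp [h.refl]
  | succ n ih =>
    rw [List.range_succ, List.map_append, List.prod_append, ← ih]
    simp [hf, h.mul_step, add_assoc]

lemma lie_eq_zero (h : IsEtaTransport M η E) {a b c d : ℤ}
    (hs : congrSign M a c * congrSign M b c * (congrSign M a d * congrSign M b d) = 1) :
    ⁅E a b, E c d⁆ = 0 := by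
  rw [Ring.lie_def, h.mul_comm_sign a b c d, hs, one_smul, sub_self]

lemma lie_eq_two_smul (h : IsEtaTransport M η E) {a b c d : ℤ}
    (hs : congrSign M a c * congrSign M b c * (congrSign M a d * congrSign M b d) = -1) :
    ⁅E a b, E c d⁆ = (2 : ℤ) • (E a b * E c d) := by
  have := h.mul_comm_sign a b c d
  rw [hs, neg_one_smul] at this
  rw [Ring.lie_def, two_smul, sub_eq_add_neg, ← this]

end IsEtaTransport

lemma sum_lie_of_ring {A ι : Type*} [Ring A] (s : Finset ι) (f : ι → A) (x : A) :
    ⁅∑ i ∈ s, f i, x⁆ = ∑ i ∈ s, ⁅f i, x⁆ := by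
  simp only [Ring.lie_def, Finset.sum_mul, Finset.mul_sum, Finset.sum_sub_distrib]

lemma lie_sum_of_ring {A ι : Type*} [Ring A] (s : Finset ι) (f : ι → A) (x : A) :
    ⁅x, ∑ i ∈ s, f i⁆ = ∑ i ∈ s, ⁅x, f i⁆ := by
  simp only [Ring.lie_def, Finset.sum_mul, Finset.mul_sum, Finset.sum_sub_distrib]

lemma sub_lie_of_ring {A : Type*} [Ring A] (x y z : A) : ⁅x - y, z⁆ = ⁅x, z⁆ - ⁅y, z⁆ := by
  simp only [Ring.lie_def]
  noncomm_ring

lemma lie_sub_of_ring {A : Type*} [Ring A] (x y z : A) : ⁅x, y - z⁆ = ⁅x, y⁆ - ⁅x, z⁆ := by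
  simp only [Ring.lie_def]
  noncomm_ring

lemma leibniz_lie_of_ring {A : Type*} [Ring A] (x y z : A) :
    ⁅x, ⁅y, z⁆⁆ = ⁅⁅x, y⁆, z⁆ + ⁅y, ⁅x, z⁆⁆ := by
  simp only [Ring.lie_def]
  noncomm_ring

lemma smul_lie_of_algebra {R A : Type*} [CommRing R] [Ring A] [Algebra R A] (r : R) (x y : A) :
    ⁅r • x, y⁆ = r • ⁅x, y⁆ := by
  simp only [Ring.lie_def, smul_mul_assoc, mul_smul_comm, smul_sub]

lemma lie_smul_of_algebra {R A : Type*} [CommRing R] [Ring A] [Algebra R A] (r : R) (x y : A) :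
    ⁅x, r • y⁆ = r • ⁅x, y⁆ := by
  simp only [Ring.lie_def, smul_mul_assoc, mul_smul_comm, smul_sub]

lemma sum_range_add_of_periodic {A : Type*} [AddCommGroup A] {N : ℕ} {f : ℤ → A}
    (hf : ∀ j, f (j + N) = f j) (t : ℤ) :
    ∑ j ∈ Finset.range N, f (j + t) = ∑ j ∈ Finset.range N, f j := by
  have key (t : ℤ) :
      ∑ j ∈ Finset.range N, f (j + (t + 1)) = ∑ j ∈ Finset.range N, f (j + t) := by
    have h1 := Finset.sum_range_succ (fun j : ℕ => f (j + t)) N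
    rw [Finset.sum_range_succ', add_comm (N : ℤ) t, hf] at h1
    simpa [add_assoc, add_comm (1 : ℤ)] using h1
  induction t using Int.induction_on with
  | zero => simp
  | succ t ih => rw [key, ih]
  | pred t ih => rw [← ih, ← key, sub_add_cancel]

lemma eq_of_dvd_sub_of_periodic {A : Type*} {N : ℤ} {f : ℤ → A}
    (hf : ∀ j, f (j + N) = f j) {i j : ℤ} (h : N ∣ i - j) : f i = f j := by
  obtain ⟨t, ht⟩ := h
  obtain rfl : i = j + t * N := by linarith
  exact (Function.Periodic.int_mul hf t) j

lemma sum_range_eq_add_of_periodic {A : Type*} [AddCommGroup A] {N : ℕ} {f : ℤ → A}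
    (hN : 0 < N) (hf : ∀ j, f (j + N) = f j) {r : ℤ} (hr : ¬ (N : ℤ) ∣ r)
    (h0 : ∀ j, ¬ (N : ℤ) ∣ j → ¬ (N : ℤ) ∣ r - j → f j = 0) :
    ∑ j ∈ Finset.range N, f j = f 0 + f r := by
  have hN' : (0 : ℤ) < N := by exact_mod_cast hN
  obtain ⟨q, hq⟩ := Int.eq_ofNat_of_zero_le (Int.emod_nonneg r hN'.ne')
  have hqN : q < N := by
    have := Int.emod_lt_of_pos r hN'
    omega
  have hrq : (N : ℤ) ∣ r - q := by rw [← hq]; exact Int.dvd_self_sub_emod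
  have hq0 : q ≠ 0 := by
    rintro rfl
    exact hr (by simpa using hrq)
  rw [eq_of_dvd_sub_of_periodic hf hrq, Finset.sum_eq_add (0 : ℕ) q hq0.symm]
  · simp
  · intro j hj hne
    rw [Finset.mem_range] at hj
    refine h0 j ?_ ?_
    · intro hd
      exact hne.1 (Nat.eq_zero_of_dvd_of_lt (by exact_mod_cast hd) hj)
    · intro hd
      have hd' : (N : ℤ) ∣ q - j := by
        have := dvd_sub hd hrq
        rwa [sub_sub_sub_cancel_left] at this
      have := Int.eq_zero_of_abs_lt_dvd hd' (by rw [abs_lt]; omega)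
      omega
  · intro h; simp [hN] at h
  · intro h; simp [hqN] at h

lemma congrSign_of_odd {N : ℕ} {x y : ℤ} (h : Odd (x - y)) : congrSign (2 * N) x y = 1 := by
  refine congrSign_of_not_dvd fun hd => ?_
  have : (2 : ℤ) ∣ x - y := (dvd_mul_right 2 _).trans hd
  rw [Int.odd_iff] at h
  omega

lemma congrSign_step_mul {M : ℤ} (hM : 2 < M) (a c : ℤ) :
    congrSign M a c * congrSign M a (c + 1) *
      (congrSign M (a + 1) c * congrSign M (a + 1) (c + 1)) =
    if M ∣ c - (a + 1) ∨ M ∣ c - (a - 1) then -1 else 1 := by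
  have h1 : ¬ M ∣ 1 := fun h => by have := Int.le_of_dvd one_pos h; omega
  have h2 : ¬ M ∣ 2 := fun h => by have := Int.le_of_dvd two_pos h; omega
  have e1 : M ∣ c - (a + 1) ↔ M ∣ a + 1 - c := dvd_sub_comm
  have e2 : M ∣ c - (a - 1) ↔ M ∣ a - (c + 1) := by
    rw [dvd_sub_comm]
    ring_nf
  have h3 : M ∣ a + 1 - c → ¬ M ∣ a - (c + 1) := fun h h' => by
    have := dvd_sub h h'
    ring_nf at this
    exact h2 this
  simp only [congrSign, e1, e2, add_sub_add_right_eq_sub]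
  by_cases hp : M ∣ a + 1 - c
  · have h4 := h3 hp
    split_ifs <;> simp_all
  · split_ifs <;> simp_all

lemma congrSign_eq_of_sub_eq {N : ℕ} {x y i : ℤ} (h : x - y = 2 * i) :
    congrSign (2 * N) x y = if (N : ℤ) ∣ i then -1 else 1 := by
  simp only [congrSign, h, mul_dvd_mul_iff_left (two_ne_zero (α := ℤ))]

namespace IsEtaTransport

variable {A : Type*} [Ring A] {N : ℕ} {η : ℤ → A} {E : ℤ → ℤ → A}

lemma sign_even_odd {x m i n : ℤ} (hn : Odd n) :
    congrSign (2 * N) x (x + 2 * i) * congrSign (2 * N) (x + 2 * m) (x + 2 * i) *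
      (congrSign (2 * N) x (x + 2 * i + n) * congrSign (2 * N) (x + 2 * m) (x + 2 * i + n)) =
    (if (N : ℤ) ∣ i then -1 else 1) * (if (N : ℤ) ∣ m - i then -1 else 1) := by
  rw [congrSign_eq_of_sub_eq (i := -i) (by ring), congrSign_eq_of_sub_eq (i := m - i) (by ring),
    congrSign_of_odd, congrSign_of_odd]
  · simp only [dvd_neg, mul_one]
  all_goals
    rw [Int.odd_iff] at *
    omega

lemma sign_odd_odd {x n p i : ℤ} (hn : Odd n) (hp : Odd p) {m : ℤ} (hm : n - p = 2 * m) :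
    congrSign (2 * N) x (x + 2 * i) * congrSign (2 * N) (x + n) (x + 2 * i) *
      (congrSign (2 * N) x (x + 2 * i + p) * congrSign (2 * N) (x + n) (x + 2 * i + p)) =
    (if (N : ℤ) ∣ i then -1 else 1) * (if (N : ℤ) ∣ m - i then -1 else 1) := by
  rw [congrSign_eq_of_sub_eq (i := -i) (by ring),
    congrSign_eq_of_sub_eq (x := x + n) (y := x + 2 * i + p) (i := m - i)
      (by linear_combination hm),
    congrSign_of_odd, congrSign_of_odd]
  · simp only [dvd_neg, mul_one, one_mul]
  all_goals
    rw [Int.odd_iff] at *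
    omega

lemma add_two_mul_period (h : IsEtaTransport (2 * N) η E) (x p j : ℤ) :
    E (x + 2 * (j + N)) (x + 2 * (j + N) + p) = E (x + 2 * j) (x + 2 * j + p) := by
  rw [← h.add_period (x + 2 * j)]
  congr 1 <;> ring

lemma sum_lie_even_odd (h : IsEtaTransport (2 * N) η E) (hN : 0 < N) (x m : ℤ) {n : ℤ}
    (hn : Odd n) :
    ∑ i ∈ Finset.range N, ⁅E x (x + 2 * m), E (x + 2 * i) (x + 2 * i + n)⁆ =
      (2 : ℤ) • E x (x + 2 * m + n) - (2 : ℤ) • E (x + 2 * m) (x + n) := by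
  have h2 : (2 : ℤ) ∣ 2 * N := dvd_mul_right _ _
  by_cases hm : (N : ℤ) ∣ m
  · have hM : (2 * N : ℤ) ∣ 2 * m := mul_dvd_mul_left 2 hm
    have e : E x (x + 2 * m + n) = E (x + 2 * m) (x + n) := by
      rw [← h.trans x (x + 2 * m), ← h.trans (x + 2 * m) x (x + n),
        h.symm_of_dvd h2 (a := x) (by simpa using hM), add_right_comm x, h.add_of_dvd hM]
    rw [Finset.sum_eq_zero, e, sub_self]
    intro i _
    apply h.lie_eq_zero
    rw [sign_even_odd hn]
    simp only [dvd_sub_right hm]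
    split_ifs <;> rfl
  · rw [sum_range_eq_add_of_periodic
      (f := fun i : ℤ => ⁅E x (x + 2 * m), E (x + 2 * i) (x + 2 * i + n)⁆) hN
      (fun j => by simp only [h.add_two_mul_period]) hm]
    · rw [h.lie_eq_two_smul, h.lie_eq_two_smul, h.trans, mul_zero, add_zero,
        ← h.trans (x + 2 * m) x, h.symm_of_even h2 (a := x)]
      · simp only [neg_mul, smul_neg, sub_neg_eq_add, add_comm]
      · simp
      · simpa [mul_dvd_mul_iff_left] using hm
      · rw [sign_even_odd hn]; simp [hm]
      · rw [sign_even_odd hn]; simp [hm]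
    · intro j h0 h1
      apply h.lie_eq_zero
      rw [sign_even_odd hn]
      simp [h0, h1]

lemma sum_lie_odd_odd (h : IsEtaTransport (2 * N) η E) (hN : 0 < N) (x : ℤ) {n p : ℤ}
    (hn : Odd n) (hp : Odd p) :
    ∑ i ∈ Finset.range N, ⁅E x (x + n), E (x + 2 * i) (x + 2 * i + p)⁆ =
      (2 : ℤ) • E x (x + (n - p)) - (2 : ℤ) • E (x + p) (x + p + (n - p)) := by
  have h2 : (2 : ℤ) ∣ 2 * N := dvd_mul_right _ _
  obtain ⟨m, hm'⟩ : ∃ m, n - p = 2 * m := (hn.sub_odd hp).exists_two_nsmul _ |>.imp (by simp)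
  by_cases hm : (N : ℤ) ∣ m
  · have hM : (2 * N : ℤ) ∣ n - p := hm' ▸ mul_dvd_mul_left 2 hm
    rw [Finset.sum_eq_zero, h.loop_eq hM x (x + p), sub_self]
    intro i _
    apply h.lie_eq_zero
    rw [sign_odd_odd hn hp hm']
    simp only [dvd_sub_right hm]
    split_ifs <;> rfl
  · rw [sum_range_eq_add_of_periodic
      (f := fun i : ℤ => ⁅E x (x + n), E (x + 2 * i) (x + 2 * i + p)⁆) hN
      (fun j => by simp only [h.add_two_mul_period]) hm]
    · rw [h.lie_eq_two_smul, h.lie_eq_two_smul, mul_zero, add_zero, ← hm',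
        show x + (n - p) + p = x + n by ring, show x + p + (n - p) = x + n by ring,
        ← h.symm_of_odd h2 (a := x + (n - p)), h.trans, ← h.symm_of_odd h2 (b := x + n), h.trans,
        h.symm_of_even h2 (b := x + n)]
      · simp only [smul_neg, sub_eq_add_neg, add_comm]
      · simpa using hn.sub_odd hp
      · rw [show x + p - (x + n) = 2 * -m by linear_combination -hm']
        simpa [mul_dvd_mul_iff_left] using hm
      · simpa using hn
      · simpa using hp
      · rw [sign_odd_odd hn hp hm']; simp [hm]
      · rw [sign_odd_odd hn hp hm']; simp [hm]
    · intro j h0 h1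
      apply h.lie_eq_zero
      rw [sign_odd_odd hn hp hm']
      simp [h0, h1]

end IsEtaTransport

/-- The sum of the `E x (x + n)` over the `N` integers `a, a + 2, …, a + 2 * (N - 1)`. -/
def transportSum {A : Type*} [Ring A] (N : ℕ) (E : ℤ → ℤ → A) (a n : ℤ) : A :=
  ∑ j ∈ Finset.range N, E (a + 2 * j) (a + 2 * j + n)

namespace IsEtaTransport

variable {A : Type*} [Ring A] {N : ℕ} {η : ℤ → A} {E : ℤ → ℤ → A}

lemma transportSum_add_two_mul (h : IsEtaTransport (2 * N) η E) (a n t : ℤ) :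
    transportSum N E (a + 2 * t) n = transportSum N E a n := by
  unfold transportSum
  rw [← sum_range_add_of_periodic (f := fun j : ℤ => E (a + 2 * j) (a + 2 * j + n))
    (fun j => h.add_two_mul_period a n j) t]
  refine Finset.sum_congr rfl fun j _ => ?_
  congr 1 <;> ring

lemma transportSum_symm (h : IsEtaTransport (2 * N) η E) (a : ℤ) {n : ℤ} (hn : Odd n) :
    transportSum N E (a + n) (-n) = transportSum N E a n := by
  refine Finset.sum_congr rfl fun j _ => ?_
  rw [← h.symm_of_odd (dvd_mul_right _ _)]
  · congr 1 <;> ring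
  · simpa using hn

lemma transportSum_symm_even (h : IsEtaTransport (2 * N) η E) (a m : ℤ)
    (hm : ¬ (N : ℤ) ∣ m) :
    transportSum N E a (2 * -m) = -transportSum N E a (2 * m) := by
  rw [← h.transportSum_add_two_mul a _ m]
  unfold transportSum
  rw [← Finset.sum_neg_distrib]
  refine Finset.sum_congr rfl fun j _ => ?_
  rw [← h.symm_of_even (dvd_mul_right _ _)]
  · congr 1 <;> ring
  · simp
  · simpa [mul_dvd_mul_iff_left] using hm

lemma transportSum_eq_of_dvd (h : IsEtaTransport (2 * N) η E) {m : ℤ} (hm : (N : ℤ) ∣ m)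
    (a b : ℤ) : transportSum N E a (2 * m) = transportSum N E b (2 * m) :=
  Finset.sum_congr rfl fun _ _ => h.loop_eq (mul_dvd_mul_left 2 hm) _ _

lemma lie_transportSum_odd_odd (h : IsEtaTransport (2 * N) η E) (hN : 0 < N) (a : ℤ) {n p : ℤ}
    (hn : Odd n) (hp : Odd p) :
    ⁅transportSum N E a n, transportSum N E a p⁆ =
      (2 : ℤ) • transportSum N E a (n - p) - (2 : ℤ) • transportSum N E (a + p) (n - p) := by
  have key (t : ℤ) : ⁅E (a + 2 * t) (a + 2 * t + n), transportSum N E a p⁆ =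
      (2 : ℤ) • E (a + 2 * t) (a + 2 * t + (n - p)) -
        (2 : ℤ) • E (a + p + 2 * t) (a + p + 2 * t + (n - p)) := by
    rw [← h.transportSum_add_two_mul a p t, transportSum, lie_sum_of_ring,
      h.sum_lie_odd_odd hN _ hn hp, add_right_comm a p]
  rw [transportSum, sum_lie_of_ring]
  simp_rw [key]
  rw [Finset.sum_sub_distrib, ← Finset.smul_sum, ← Finset.smul_sum]
  rfl

lemma lie_transportSum_even_odd (h : IsEtaTransport (2 * N) η E) (hN : 0 < N) (a m : ℤ) {n : ℤ}
    (hn : Odd n) :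
    ⁅transportSum N E a (2 * m), transportSum N E a n⁆ =
      (2 : ℤ) • transportSum N E a (n + 2 * m) - (2 : ℤ) • transportSum N E a (n - 2 * m) := by
  have key (t : ℤ) : ⁅E (a + 2 * t) (a + 2 * t + 2 * m), transportSum N E a n⁆ =
      (2 : ℤ) • E (a + 2 * t) (a + 2 * t + (n + 2 * m)) -
        (2 : ℤ) • E (a + 2 * m + 2 * t) (a + 2 * m + 2 * t + (n - 2 * m)) := by
    rw [← h.transportSum_add_two_mul a n t, transportSum, lie_sum_of_ring,
      h.sum_lie_even_odd hN _ _ hn, add_right_comm a (2 * m)]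
    congr 3 <;> ring
  rw [← h.transportSum_add_two_mul a (n - 2 * m) m]
  conv_lhs => rw [transportSum, sum_lie_of_ring]
  simp_rw [key]
  rw [Finset.sum_sub_distrib, ← Finset.smul_sum, ← Finset.smul_sum]
  rfl

end IsEtaTransport

/-- The elements `A_l` and `G_l` built from the operators `η_j`
(satisfying the cyclic relations mod `2N`) obey the defining relations of the
Onsager algebra: `[A_j, A_k] = 4 G_{j−k}`, `[G_m, A_l] = 2 A_{l+m} − 2 A_{l−m}` and
`[G_j, G_k] = 0`.  Ordered products of consecutive `η`'s are taken as `List.prod`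
over increasing indices (read mod `2N`). -/
theorem onsager_relations_of_eta_relations
    (N : ℕ) (hN : 2 ≤ N) (A : Type*) [Ring A] [Algebra ℂ A]
    (η : ZMod (2 * N) → A)
    (hanti : ∀ j : ZMod (2 * N), η j * η (j + 1) = -(η (j + 1) * η j))
    (hcomm : ∀ j k : ZMod (2 * N), k ≠ j + 1 → k ≠ j - 1 → η j * η k = η k * η j)
    (hsq : ∀ j : ZMod (2 * N), η j ^ 2 = 1)
    (AA GG : ℤ → A)
    (hA0 : AA 0 = ∑ j ∈ Finset.range N, η (2 * (j : ZMod (2 * N)) + 1))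
    (hApos : ∀ l : ℕ, 1 ≤ l →
      AA l = ∑ j ∈ Finset.range N,
        ((List.range (2 * l - 1)).map
          (fun i => η (2 * ((j : ZMod (2 * N)) + 1) + (i : ZMod (2 * N))))).prod)
    (hAneg : ∀ l : ℕ, 1 ≤ l →
      AA (-(l : ℤ)) = ∑ j ∈ Finset.range N,
        ((List.range (2 * l + 1)).map
          (fun i => η (2 * ((j : ZMod (2 * N)) + 1) - (2 * (l : ZMod (2 * N)) + 1)
            + (i : ZMod (2 * N))))).prod)
    (hG0 : GG 0 = 0)
    (hGpos : ∀ l : ℕ, 1 ≤ l →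
      GG l = (2 : ℂ)⁻¹ • ∑ j ∈ Finset.range N,
        (((List.range (2 * l)).map
            (fun i => η (2 * ((j : ZMod (2 * N)) + 1) + (i : ZMod (2 * N))))).prod
          - ((List.range (2 * l)).map
            (fun i => η (2 * ((j : ZMod (2 * N)) + 1) - 1 + (i : ZMod (2 * N))))).prod))
    (hGneg : ∀ l : ℕ, 1 ≤ l → GG (-(l : ℤ)) = -GG l) :
    (∀ j k : ℤ, ⁅AA j, AA k⁆ = (4 : ℂ) • GG (j - k)) ∧
    (∀ m l : ℤ, ⁅GG m, AA l⁆ = (2 : ℂ) • AA (l + m) - (2 : ℂ) • AA (l - m)) ∧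
    (∀ j k : ℤ, ⁅GG j, GG k⁆ = 0) := by
  have hN0 : 0 < N := by omega
  have dvd_iff (i j : ℤ) : 2 * (N : ℤ) ∣ i - j ↔ (i : ZMod (2 * N)) = (j : ZMod (2 * N)) := by
    rw [eq_comm, ZMod.intCast_eq_intCast_iff_dvd_sub]
    push_cast
    rfl
  obtain ⟨E, h⟩ := IsEtaTransport.exists_of_sq_eq_one (M := 2 * N)
    (η := fun n : ℤ => η n) (fun a => by rw [← sq, hsq])
    (fun a => congrArg η ((dvd_iff _ _).1 (by simp)))
    (fun a c => by
      rw [congrSign_step_mul (by omega)]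
      simp only [dvd_iff]
      push_cast
      split_ifs with h0
      · rw [neg_one_smul]
        rcases h0 with h0 | h0
        · rw [h0, hanti]
        · have := hanti (a - 1)
          rw [sub_add_cancel] at this
          rw [h0, this, neg_neg]
      · rw [one_smul]
        exact hcomm _ _ (fun e => h0 (Or.inl e)) (fun e => h0 (Or.inr e)))
  have hA_zero : AA 0 = transportSum N E (0 + 2 * 1) (2 * 0 - 1) := by
    rw [hA0]
    refine Finset.sum_congr rfl fun j _ => ?_
    rw [h.symm_of_odd (dvd_mul_right _ _) (by simp)]
    have e := h.step (2 * j + 1)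
    push_cast at e
    rw [← e]
    congr 1 <;> ring
  have hA (l : ℤ) : AA l = transportSum N E 0 (2 * l - 1) := by
    rw [← h.transportSum_add_two_mul 0 _ 1]
    obtain ⟨l, rfl | rfl⟩ := l.eq_nat_or_neg
    · rcases Nat.eq_zero_or_pos l with rfl | hl
      · rw [Nat.cast_zero, hA_zero]
      · rw [hApos l hl]
        refine Finset.sum_congr rfl fun j _ => ?_
        refine (h.eq_list_prod _ _ _ _ (by omega) fun i => ?_).symm
        push_cast
        congr 1
        ring
    · rcases Nat.eq_zero_or_pos l with rfl | hl
      · rw [Nat.cast_zero, neg_zero, hA_zero]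
      · rw [hAneg l hl]
        refine Finset.sum_congr rfl fun j _ => ?_
        rw [h.symm_of_odd (dvd_mul_right _ _) ⟨l, by ring⟩]
        refine (h.eq_list_prod _ _ _ _ (by push_cast; ring) fun i => ?_).symm
        push_cast
        congr 1
        ring
  have hG (m : ℤ) : (2 : ℂ) • GG m = transportSum N E 0 (2 * m) - transportSum N E 1 (2 * m) := by
    have hpos (l : ℕ) (hl : 1 ≤ l) :
        (2 : ℂ) • GG l = transportSum N E 0 (2 * l) - transportSum N E 1 (2 * l) := by
      rw [hGpos l hl, smul_inv_smul₀ two_ne_zero, ← h.transportSum_add_two_mul 0 _ 1,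
        Finset.sum_sub_distrib]
      congr 1
      all_goals
        refine Finset.sum_congr rfl fun j _ => ?_
        refine (h.eq_list_prod _ _ _ _ (by push_cast; rfl) fun i => ?_).symm
        push_cast
        congr 1
        ring
    obtain ⟨l, rfl | rfl⟩ := m.eq_nat_or_neg <;> rcases Nat.eq_zero_or_pos l with rfl | hl
    · simp [hG0, transportSum, h.refl]
    · exact hpos l hl
    · simp [hG0, transportSum, h.refl]
    · rw [hGneg l hl, smul_neg, hpos l hl]
      by_cases hd : (N : ℤ) ∣ l
      · rw [h.transportSum_eq_of_dvd hd 0 1,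
          h.transportSum_eq_of_dvd (dvd_neg.2 hd) 0 1, sub_self, sub_self, neg_zero]
      · rw [h.transportSum_symm_even 0 _ hd, h.transportSum_symm_even 1 _ hd]
        abel
  have odd_sub_one (l : ℤ) : Odd (2 * l - 1) := ⟨l - 1, by ring⟩
  have hA' (l : ℤ) : AA l = transportSum N E 1 (1 - 2 * l) := by
    rw [hA, ← h.transportSum_symm 0 (odd_sub_one l), ← h.transportSum_add_two_mul _ _ (1 - l)]
    congr 1 <;> ring
  have hAA (j k : ℤ) : ⁅AA j, AA k⁆ = (4 : ℂ) • GG (j - k) := by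
    rw [show (4 : ℂ) = 2 * 2 by norm_num, mul_smul, hG, hA, hA,
      h.lie_transportSum_odd_odd hN0 _ (odd_sub_one j) (odd_sub_one k),
      ← h.transportSum_add_two_mul 1 _ (k - 1),
      show 2 * j - 1 - (2 * k - 1) = 2 * (j - k) by ring,
      show 1 + 2 * (k - 1) = 0 + (2 * k - 1) by ring]
    module
  have hGA (m l : ℤ) : ⁅GG m, AA l⁆ = (2 : ℂ) • AA (l + m) - (2 : ℂ) • AA (l - m) := by
    have e0 := h.lie_transportSum_even_odd hN0 0 m (odd_sub_one l)
    have e1 := h.lie_transportSum_even_odd hN0 1 m (n := 1 - 2 * l) ⟨-l, by ring⟩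
    rw [← hA, show 2 * l - 1 + 2 * m = 2 * (l + m) - 1 by ring,
      show 2 * l - 1 - 2 * m = 2 * (l - m) - 1 by ring, ← hA, ← hA] at e0
    rw [← hA', show 1 - 2 * l + 2 * m = 1 - 2 * (l - m) by ring,
      show 1 - 2 * l - 2 * m = 1 - 2 * (l + m) by ring, ← hA', ← hA'] at e1
    have e2 : (2 : ℂ) • ⁅GG m, AA l⁆ = (2 : ℂ) • ((2 : ℂ) • AA (l + m) - (2 : ℂ) • AA (l - m)) := by
      rw [← smul_lie_of_algebra, hG, sub_lie_of_ring, e0, e1]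
      module
    exact smul_right_injective A (two_ne_zero (α := ℂ)) e2
  refine ⟨hAA, hGA, fun j k => ?_⟩
  have e : (4 : ℂ) • ⁅GG j, GG k⁆ = (4 : ℂ) • (0 : A) := by
    have hk := hAA k 0
    rw [sub_zero] at hk
    rw [← lie_smul_of_algebra, ← hk, leibniz_lie_of_ring, hGA, hGA]
    simp only [sub_lie_of_ring, lie_sub_of_ring, smul_lie_of_algebra, lie_smul_of_algebra, hAA,
      zero_add, zero_sub, sub_zero, smul_zero]
    rw [show k - -j = k + j by ring]
    module
  exact smul_right_injective A (by norm_num : (4 : ℂ) ≠ 0) e
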